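/- Let h(y) = a·y + b·log y + c with a ≤ 0 and b < 0, and let y₀ > 0 be the unique zero of h. If the initial value 1 satisfies 1 < y₀ (resp. 1 > y₀), then the unique solution of y' = h(y), y(0) = 1 exists on [0, ∞), is strictly increasing (resp. strictly decreasing), stays in the open interval between 1 and y₀, and converges to y₀ as t → ∞. -/

import Mathlib

open Filter

lemma aux_global (g : ℝ → ℝ) (K L : NNReal) (hg : LipschitzWith K g) (hL : ∀ x, |g x| ≤ L)
    (x₀ : ℝ) : ∃ y : ℝ → ℝ, y 0 = x₀ ∧ ∀ t, HasDerivAt y (g (y t)) t := by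
  have loc : ∀ n : ℕ, ∃ y : ℝ → ℝ, y 0 = x₀ ∧
      ∀ t ∈ Set.Ioo (-((n:ℝ)+1)) ((n:ℝ)+1), HasDerivAt y (g (y t)) t := by
    intro n
    have hn : (0:ℝ) ≤ n := Nat.cast_nonneg n
    have h0 : (0:ℝ) ∈ Set.Icc (-((n:ℝ)+1)) ((n:ℝ)+1) := ⟨by linarith, by linarith⟩
    have hp : IsPicardLindelof (fun _ => g) (⟨0, h0⟩ : Set.Icc (-((n:ℝ)+1)) ((n:ℝ)+1)) x₀
        (L * (n + 1)) 0 L K := by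
      apply IsPicardLindelof.of_time_independent
      · intro x _
        exact hL x
      · exact hg.lipschitzOnWith
      · simp
    obtain ⟨y, hy0, hy⟩ := hp.exists_eq_forall_mem_Icc_hasDerivWithinAt₀
    exact ⟨y, hy0, fun t ht => (hy t (Set.Ioo_subset_Icc_self ht)).hasDerivAt
      (Icc_mem_nhds ht.1 ht.2)⟩
  choose Y hY0 hY using loc
  have hle : ∀ m n : ℕ, m ≤ n → ∀ t ∈ Set.Ioo (-((m:ℝ)+1)) ((m:ℝ)+1), Y m t = Y n t := by
    intro m n hmn
    have hm : (0:ℝ) ≤ m := Nat.cast_nonneg m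
    have hmn' : (m:ℝ) ≤ n := by exact_mod_cast hmn
    refine ODE_solution_unique_of_mem_Ioo (v := fun _ => g) (s := fun _ => Set.univ) (K := K)
      (t₀ := 0) (fun _ _ => hg.lipschitzOnWith) ⟨by linarith, by linarith⟩
      (fun t ht => ⟨hY m t ht, trivial⟩)
      (fun t ht => ⟨hY n t ⟨by linarith [ht.1], by linarith [ht.2]⟩, trivial⟩) ?_
    rw [hY0, hY0]
  have heq : ∀ m n : ℕ, ∀ t : ℝ, |t| < m + 1 → |t| < n + 1 → Y m t = Y n t := by
    intro m n t h1 h2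
    rw [abs_lt] at h1 h2
    rcases le_total m n with h | h
    · exact hle m n h t h1
    · exact (hle n m h t h2).symm
  refine ⟨fun t => Y ⌈|t|⌉₊ t, hY0 _, fun t => ?_⟩
  have hc : ∀ s : ℝ, |s| < (⌈|s|⌉₊ : ℝ) + 1 := fun s => by linarith [Nat.le_ceil |s|]
  have h1 := hY ⌈|t|⌉₊ t (abs_lt.mp (hc t))
  refine h1.congr_of_eventuallyEq ?_
  have : ∀ᶠ s in nhds t, |s| < (⌈|t|⌉₊ : ℝ) + 1 :=
    (continuous_abs.tendsto t).eventually (gt_mem_nhds (hc t))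
  filter_upwards [this] with s hs
  exact heq _ _ s (hc s) hs

lemma aux_incr (g : ℝ → ℝ) (K L : NNReal) (hg : LipschitzWith K g) (hL : ∀ x, |g x| ≤ L)
    (hanti : Antitone g) (p x₀ : ℝ) (hp : g p = 0) (hpos : ∀ x, x < p → 0 < g x) (hx : x₀ < p) :
    ∃ y : ℝ → ℝ, y 0 = x₀ ∧ (∀ t, HasDerivAt y (g (y t)) t) ∧ StrictMono y ∧ (∀ t, y t < p) ∧
      Tendsto y atTop (nhds p) := by
  obtain ⟨y, h0, hd⟩ := aux_global g K L hg hL x₀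
  have hcont : Continuous y := continuous_iff_continuousAt.2 fun t => (hd t).continuousAt
  have hne : ∀ t, y t ≠ p := by
    intro t ht
    have : y = fun _ => p := by
      refine ODE_solution_unique_univ (v := fun _ => g) (s := fun _ => Set.univ) (K := K)
        (t₀ := t) (fun _ => hg.lipschitzOnWith) (fun t => ⟨hd t, trivial⟩)
        (fun t => ⟨?_, trivial⟩) ht
      simp only [hp]
      exact hasDerivAt_const t p
    rw [this] at h0
    simp only at h0
    linarith
  have hlt : ∀ t, y t < p := by
    intro t
    by_contra hc
    push Not at hc
    obtain ⟨s, hs⟩ := mem_range_of_exists_le_of_exists_ge hcont ⟨0, by rw [h0]; exact hx.le⟩ ⟨t, hc⟩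
    exact hne s hs
  have hmono : StrictMono y := strictMono_of_deriv_pos fun t => by
    rw [(hd t).deriv]; exact hpos _ (hlt t)
  refine ⟨y, h0, hd, hmono, hlt, ?_⟩
  have hbdd : BddAbove (Set.range y) := ⟨p, by rintro _ ⟨t, rfl⟩; exact (hlt t).le⟩
  have hlim := tendsto_atTop_ciSup hmono.monotone hbdd
  set l := ⨆ i, y i with hl
  have hyl : ∀ t, y t ≤ l := fun t => le_ciSup hbdd t
  have hlp : l ≤ p := ciSup_le fun t => (hlt t).le
  rcases hlp.lt_or_eq with hlp | hlp
  · exfalso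
    have hgl := hpos l hlp
    have hm2 : Monotone fun t => y t - g l * t := by
      have hd2 : ∀ t, HasDerivAt (fun t => y t - g l * t) (g (y t) - g l * 1) t := fun t =>
        (hd t).sub ((hasDerivAt_id t).const_mul (g l))
      refine monotone_of_deriv_nonneg (fun t => (hd2 t).differentiableAt) fun t => ?_
      rw [(hd2 t).deriv]
      have := hanti (hyl t)
      linarith
    have h3 := hm2 (show (0:ℝ) ≤ (p - x₀) / g l from div_nonneg (by linarith) hgl.le)
    simp only [h0] at h3
    rw [mul_div_cancel₀ _ hgl.ne'] at h3
    have := hlt ((p - x₀) / g l)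
    linarith
  · rwa [hlp] at hlim

lemma aux_log (x y m : ℝ) (hm : 0 < m) (hx : m ≤ x) (hy : m ≤ y) :
    |Real.log x - Real.log y| ≤ |x - y| / m := by
  wlog h : y ≤ x generalizing x y
  · rw [abs_sub_comm, abs_sub_comm x]
    exact this y x hy hx (by linarith)
  have hy0 : 0 < y := by linarith
  have hx0 : 0 < x := by linarith
  have h1 := Real.log_le_log hy0 h
  rw [abs_of_nonneg (by linarith), abs_of_nonneg (by linarith), ← Real.log_div hx0.ne' hy0.ne']
  have h2 := Real.log_le_sub_one_of_pos (div_pos hx0 hy0)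
  have h3 : x / y - 1 = (x - y) / y := by field_simp
  have h4 : (x - y) / y ≤ (x - y) / m := div_le_div_of_nonneg_left (by linarith) hm hy
  linarith

theorem stmt_14 (a b c y₀ : ℝ) (ha : a ≤ 0) (hb : b < 0)
    (h : ℝ → ℝ) (hh : ∀ y, h y = a * y + b * Real.log y + c)
    (hy₀ : 0 < y₀) (hzero : h y₀ = 0) (hne : (1 : ℝ) ≠ y₀) :
    ∃ y : ℝ → ℝ,
      y 0 = 1 ∧
      (∀ t, 0 ≤ t → 0 < y t) ∧
      (∀ t, 0 ≤ t → HasDerivAt y (h (y t)) t) ∧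
      ((1 : ℝ) < y₀ → StrictMonoOn y (Set.Ici 0)) ∧
      (y₀ < 1 → StrictAntiOn y (Set.Ici 0)) ∧
      (∀ t, 0 < t → y t ∈ Set.Ioo (min 1 y₀) (max 1 y₀)) ∧
      Tendsto y atTop (nhds y₀) ∧
      (∀ z : ℝ → ℝ, z 0 = 1 → (∀ t, 0 ≤ t → 0 < z t) →
        (∀ t, 0 ≤ t → HasDerivAt z (h (z t)) t) →
        ∀ t, 0 ≤ t → z t = y t) := by
  have hanti : ∀ x y, 0 < x → x < y → h y < h x := by
    intro x y hx hxy
    rw [hh, hh]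
    have := Real.log_lt_log hx hxy
    nlinarith
  have hanti' : ∀ x y, 0 < x → x ≤ y → h y ≤ h x := by
    intro x y hx hxy
    rcases hxy.lt_or_eq with h1 | h1
    · exact (hanti x y hx h1).le
    · rw [h1]
  -- uniqueness
  have huniq : ∀ y : ℝ → ℝ, y 0 = 1 → (∀ t, 0 ≤ t → 0 < y t) →
      (∀ t, 0 ≤ t → HasDerivAt y (h (y t)) t) →
      (∀ z : ℝ → ℝ, z 0 = 1 → (∀ t, 0 ≤ t → 0 < z t) →
        (∀ t, 0 ≤ t → HasDerivAt z (h (z t)) t) → ∀ t, 0 ≤ t → z t = y t) := by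
    intro y y0 yp yd z z0 zp zd t ht
    have hd : ∀ t, 0 ≤ t → HasDerivAt (fun t => (z t - y t) * (z t - y t))
        ((h (z t) - h (y t)) * (z t - y t) + (z t - y t) * (h (z t) - h (y t))) t := fun t ht =>
      ((zd t ht).sub (yd t ht)).mul ((zd t ht).sub (yd t ht))
    have hA : AntitoneOn (fun t => (z t - y t) * (z t - y t)) (Set.Ici 0) := by
      refine antitoneOn_of_deriv_nonpos (convex_Ici 0)
        (fun t ht => (hd t ht).continuousAt.continuousWithinAt)
        (fun t ht => ?_) (fun t ht => ?_)
      · exact (hd t (interior_subset ht)).differentiableAt.differentiableWithinAt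
      · have ht' : 0 ≤ t := interior_subset ht
        rw [(hd t ht').deriv]
        rcases le_total (z t) (y t) with h1 | h1
        · have := hanti' _ _ (zp t ht') h1
          nlinarith
        · have := hanti' _ _ (yp t ht') h1
          nlinarith
    have h1 := hA (Set.mem_Ici.2 le_rfl) (Set.mem_Ici.2 ht) ht
    simp only [z0, y0, sub_self, mul_zero] at h1
    have : z t - y t = 0 := mul_self_eq_zero.1 (le_antisymm h1 (mul_self_nonneg _))
    linarith
  set m := min 1 y₀ with hm
  set M := max 1 y₀ with hM
  have hm0 : 0 < m := lt_min one_pos hy₀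
  have hmM : m ≤ M := min_le_max
  have hm1 : m ≤ 1 := min_le_left _ _
  have hmy : m ≤ y₀ := min_le_right _ _
  have hM1 : 1 ≤ M := le_max_left _ _
  have hMy : y₀ ≤ M := le_max_right _ _
  obtain ⟨q, hq⟩ : ∃ q : ℝ → ℝ, ∀ x, q x = max m (min x M) := ⟨_, fun _ => rfl⟩
  have hqm : ∀ x, m ≤ q x := fun x => by rw [hq]; exact le_max_left _ _
  have hqM : ∀ x, q x ≤ M := fun x => by rw [hq]; exact max_le hmM (min_le_right _ _)
  have hqid : ∀ x, m ≤ x → x ≤ M → q x = x := fun x h1 h2 => by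
    rw [hq, min_eq_left h2, max_eq_right h1]
  have hqmono : ∀ x y, x ≤ y → q x ≤ q y := fun x y hxy => by
    rw [hq, hq]; gcongr
  have hqlip : ∀ x y, |q x - q y| ≤ |x - y| := fun x y => by
    rw [hq, hq]; grind
  have hK0 : 0 ≤ |a| + |b| / m := by positivity
  have hlip : ∀ x y, |h (q x) - h (q y)| ≤ (|a| + |b| / m) * |q x - q y| := fun x y => by
    have e : h (q x) - h (q y) = a * (q x - q y) + b * (Real.log (q x) - Real.log (q y)) := by
      rw [hh, hh]; ring
    rw [e]
    refine (abs_add_le _ _).trans ?_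
    rw [abs_mul, abs_mul]
    have := mul_le_mul_of_nonneg_left (aux_log _ _ m hm0 (hqm x) (hqm y)) (abs_nonneg b)
    calc _ ≤ |a| * |q x - q y| + |b| * (|q x - q y| / m) := by linarith
      _ = _ := by ring
  have hqy : q y₀ = y₀ := hqid _ hmy hMy
  have hLip : LipschitzWith ⟨_, hK0⟩ (fun x => h (q x)) := LipschitzWith.of_dist_le_mul fun x y => by
    rw [Real.dist_eq, Real.dist_eq]
    exact (hlip x y).trans (mul_le_mul_of_nonneg_left (hqlip x y) hK0)
  have hB0 : 0 ≤ (|a| + |b| / m) * (M - m) := mul_nonneg hK0 (by linarith)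
  have hB : ∀ x, |h (q x)| ≤ (|a| + |b| / m) * (M - m) := fun x => by
    have h1 := hlip x y₀
    rw [hqy, hzero, sub_zero] at h1
    refine h1.trans (mul_le_mul_of_nonneg_left ?_ hK0)
    rw [abs_le]
    constructor <;> linarith [hqm x, hqM x]
  have hgA : Antitone (fun x => h (q x)) := fun x y hxy =>
    hanti' _ _ (hm0.trans_le (hqm x)) (hqmono x y hxy)
  rcases lt_or_gt_of_ne hne with h1 | h1
  · have em : m = 1 := min_eq_left h1.le
    have eM : M = y₀ := max_eq_right h1.le
    obtain ⟨y, y0, yd, ym, yl, yt⟩ := aux_incr (fun x => h (q x)) ⟨_, hK0⟩ ⟨_, hB0⟩ hLip hB hgA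
      y₀ 1 (by simp only [hqy, hzero]) (fun x hx => by
        have : q x < y₀ := by rw [hq, em, eM, min_eq_left hx.le]; exact max_lt h1 hx
        have := hanti _ _ (hm0.trans_le (hqm x)) this
        linarith) h1
    have hge : ∀ t, 0 ≤ t → 1 ≤ y t := fun t ht => by
      rw [← y0]; exact ym.monotone ht
    have ypos : ∀ t, 0 ≤ t → 0 < y t := fun t ht => by linarith [hge t ht]
    have yd' : ∀ t, 0 ≤ t → HasDerivAt y (h (y t)) t := fun t ht => by
      have := yd t
      rwa [hqid (y t) (by rw [em]; exact hge t ht) (by rw [eM]; exact (yl t).le)] at this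
    refine ⟨y, y0, ypos, yd', fun _ => ym.strictMonoOn _, fun h2 => absurd h2 h1.not_gt,
      fun t ht => ?_, yt, huniq y y0 ypos yd'⟩
    rw [em, eM]
    exact ⟨by rw [← y0]; exact ym ht, yl t⟩
  · have em : m = y₀ := min_eq_right h1.le
    have eM : M = 1 := max_eq_left h1.le
    obtain ⟨w, w0, wd, wm, wl, wt⟩ := aux_incr (fun x => -h (q (-x))) ⟨_, hK0⟩ ⟨_, hB0⟩
      (LipschitzWith.of_dist_le_mul fun x y => by
        have := hLip.dist_le_mul (-x) (-y)
        rwa [dist_neg_neg] at this ⊢)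
      (fun x => by rw [abs_neg]; exact hB _)
      (fun x y hxy => neg_le_neg (hgA (neg_le_neg hxy)))
      (-y₀) (-1) (by simp only [neg_neg, hqy, hzero, neg_zero]) (fun x hx => by
        have h2 : y₀ < -x := by linarith
        have : y₀ < q (-x) := by rw [hq]; exact lt_max_of_lt_right (lt_min h2 (by rw [eM]; exact h1))
        have := hanti _ _ hy₀ this
        linarith) (by linarith)
    have hgt : ∀ t, y₀ < - w t := fun t => by linarith [wl t]
    have hle : ∀ t, 0 ≤ t → - w t ≤ 1 := fun t ht => by
      have := wm.monotone ht
      linarith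
    have y0 : (fun t => - w t) 0 = 1 := by simp [w0]
    have ypos : ∀ t, 0 ≤ t → 0 < (fun t => - w t) t := fun t _ => hy₀.trans (hgt t)
    have yd' : ∀ t, 0 ≤ t → HasDerivAt (fun t => - w t) (h ((fun t => - w t) t)) t := fun t ht => by
      have := (wd t).neg
      simp only [neg_neg] at this
      rwa [hqid (- w t) (by rw [em]; exact (hgt t).le) (by rw [eM]; exact hle t ht)] at this
    refine ⟨fun t => - w t, y0, ypos, yd', fun h2 => absurd h2 h1.not_gt,
      fun _ s _ t _ hst => neg_lt_neg (wm hst), fun t ht => ?_, ?_, huniq _ y0 ypos yd'⟩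
    · rw [em, eM]
      exact ⟨hgt t, by have := wm ht; simp only; linarith⟩
    · simpa using wt.neg
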